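/- Let ε > 0, β ∈ ℝ, let φ : ℝ → ℂ be differentiable, and set u_ε(y) = (πε)^{-1/4} exp(−y²/(2ε)), f(y) = ∫_ℝ sgn(y−y′) u_ε(y′)² dy′, and j₁(x,y) = ( Im( φ̄(x) φ'(x) ) − πβ f(y) |φ(x)|⁴ ) u_ε(y)². Then for every x ∈ ℝ, −2β φ(x) ∫_ℝ ( −π ∫_ℝ sgn(y−y′) j₁(x,y′) dy′ ) u_ε(y)² dy = (2/3) π² β² |φ(x)|⁴ φ(x). That is, the projection onto u_ε of the current self-interaction term −2β (T₀ ⋆ j) Φ of the Chern-Simons-Schrödinger equation equals (2/3) π² β² |φ|⁴ φ. -/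

import Mathlib

open MeasureTheory

/-- The Gaussian ground state `u_ε(y) = (πε)^{-1/4} exp(−y²/(2ε))`. -/
noncomputable def uGauss (ε y : ℝ) : ℝ :=
  (Real.pi * ε) ^ (-(1/4 : ℝ)) * Real.exp (-(y^2) / (2*ε))

/-- `f(y) = ∫ sgn(y−y′) u_ε(y′)² dy′`. -/
noncomputable def fSgn (ε y : ℝ) : ℝ :=
  ∫ y' : ℝ, Real.sign (y - y') * (uGauss ε y')^2

/-- First component of the current of the quasi-1D ansatz:
`j₁(x,y) = (Im(φ̄(x) φ'(x)) − πβ f(y)|φ(x)|⁴) u_ε(y)²`. -/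
noncomputable def j1 (ε β : ℝ) (φ : ℝ → ℂ) (x y : ℝ) : ℝ :=
  (((starRingEnd ℂ) (φ x) * deriv φ x).im
    - Real.pi * β * fSgn ε y * ‖φ x‖^4) * (uGauss ε y)^2


lemma cs_g_eq (ε : ℝ) (hε : 0 < ε) (y : ℝ) :
    (uGauss ε y)^2 = (Real.sqrt (Real.pi * ε))⁻¹ * Real.exp (-(1/ε) * y^2) := by
  have hp : 0 < Real.pi * ε := by positivity
  unfold uGauss
  rw [mul_pow, ← Real.exp_nat_mul, ← Real.rpow_natCast, ← Real.rpow_mul hp.le,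
    Real.sqrt_eq_rpow, ← Real.rpow_neg hp.le]
  congr 2
  · norm_num
  · push_cast; field_simp

lemma cs_g_int (ε : ℝ) (hε : 0 < ε) : Integrable (fun y => (uGauss ε y)^2) := by
  simp_rw [cs_g_eq ε hε]
  exact (integrable_exp_neg_mul_sq (by positivity)).const_mul _

lemma cs_g_one (ε : ℝ) (hε : 0 < ε) : ∫ y, (uGauss ε y)^2 = 1 := by
  simp_rw [cs_g_eq ε hε]
  rw [integral_const_mul, integral_gaussian]
  have : Real.pi / (1/ε) = Real.pi * ε := by field_simp
  rw [this]
  exact inv_mul_cancel₀ (by positivity)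

lemma cs_g_cont (ε : ℝ) : Continuous (fun y => (uGauss ε y)^2) := by
  unfold uGauss; fun_prop

lemma cs_sign_le (t : ℝ) : ‖Real.sign t‖ ≤ 1 := by
  rcases Real.sign_apply_eq t with h | h | h <;> rw [h] <;> simp

lemma cs_sign_meas : Measurable Real.sign := by
  unfold Real.sign
  exact Measurable.ite measurableSet_Iio measurable_const
    (Measurable.ite measurableSet_Ioi measurable_const measurable_const)

lemma cs_f_eq (ε : ℝ) (hε : 0 < ε) (y : ℝ) :
    fSgn ε y = 2 * (∫ t in Set.Iic y, (uGauss ε t)^2) - 1 := by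
  unfold fSgn
  rw [← cs_g_one ε hε, ← integral_indicator measurableSet_Iic, ← integral_const_mul,
    ← integral_sub (((cs_g_int ε hε).indicator measurableSet_Iic).const_mul _) (cs_g_int ε hε)]
  apply integral_congr_ae
  have : ∀ᵐ t : ℝ, t ≠ y := by simp [ae_iff]
  filter_upwards [this] with t ht
  rcases lt_or_gt_of_ne ht with h | h
  · rw [Real.sign_of_pos (by linarith), Set.indicator_of_mem (by exact h.le)]; ring
  · rw [Real.sign_of_neg (by linarith), Set.indicator_of_notMem (by simpa using h)]; ring

lemma cs_f_deriv (ε : ℝ) (hε : 0 < ε) (y : ℝ) :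
    HasDerivAt (fSgn ε) (2 * (uGauss ε y)^2) y := by
  have hg := cs_g_int ε hε
  have e : fSgn ε = fun y => 2 * ((∫ t in Set.Iic 0, (uGauss ε t)^2)
      + ∫ t in (0:ℝ)..y, (uGauss ε t)^2) - 1 := by
    funext y
    rw [cs_f_eq ε hε, ← intervalIntegral.integral_Iic_sub_Iic hg.integrableOn hg.integrableOn]
    ring
  rw [e]
  exact (((cs_g_cont ε).integral_hasStrictDerivAt 0 y).hasDerivAt.const_add _ |>.const_mul 2).sub_const 1

lemma cs_f_top (ε : ℝ) (hε : 0 < ε) : Filter.Tendsto (fSgn ε) Filter.atTop (nhds 1) := by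
  have hg := cs_g_int ε hε
  rw [← cs_g_one ε hε]
  unfold fSgn
  refine tendsto_integral_filter_of_dominated_convergence (fun y => (uGauss ε y)^2) ?_ ?_ hg ?_
  · refine Filter.Eventually.of_forall fun y => ?_
    exact ((cs_sign_meas.comp (measurable_const.sub measurable_id)).mul
      (cs_g_cont ε).measurable).aestronglyMeasurable
  · refine Filter.Eventually.of_forall fun y => Filter.Eventually.of_forall fun t => ?_
    rw [norm_mul, Real.norm_of_nonneg (sq_nonneg (uGauss ε t))]
    exact mul_le_of_le_one_left (sq_nonneg _) (cs_sign_le _)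
  · refine Filter.Eventually.of_forall fun t => ?_
    refine tendsto_const_nhds.congr' ?_
    filter_upwards [Filter.eventually_gt_atTop t] with y hy
    rw [Real.sign_of_pos (by linarith), one_mul]

lemma cs_f_bot (ε : ℝ) (hε : 0 < ε) : Filter.Tendsto (fSgn ε) Filter.atBot (nhds (-1)) := by
  have hg := cs_g_int ε hε
  rw [← cs_g_one ε hε, ← integral_neg]
  unfold fSgn
  refine tendsto_integral_filter_of_dominated_convergence (fun y => (uGauss ε y)^2) ?_ ?_ hg ?_
  · refine Filter.Eventually.of_forall fun y => ?_
    exact ((cs_sign_meas.comp (measurable_const.sub measurable_id)).mul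
      (cs_g_cont ε).measurable).aestronglyMeasurable
  · refine Filter.Eventually.of_forall fun y => Filter.Eventually.of_forall fun t => ?_
    rw [norm_mul, Real.norm_of_nonneg (sq_nonneg (uGauss ε t))]
    exact mul_le_of_le_one_left (sq_nonneg _) (cs_sign_le _)
  · refine Filter.Eventually.of_forall fun t => ?_
    refine tendsto_const_nhds.congr' ?_
    filter_upwards [Filter.eventually_lt_atBot t] with y hy
    rw [Real.sign_of_neg (by linarith), neg_one_mul]

lemma cs_f_le (ε : ℝ) (hε : 0 < ε) (y : ℝ) : ‖fSgn ε y‖ ≤ 1 := by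
  rw [← cs_g_one ε hε]
  unfold fSgn
  refine norm_integral_le_of_norm_le (cs_g_int ε hε) (Filter.Eventually.of_forall fun t => ?_)
  rw [norm_mul, Real.norm_of_nonneg (sq_nonneg (uGauss ε t))]
  exact mul_le_of_le_one_left (sq_nonneg _) (cs_sign_le _)

lemma cs_f_cont (ε : ℝ) (hε : 0 < ε) : Continuous (fSgn ε) :=
  continuous_iff_continuousAt.2 fun y => (cs_f_deriv ε hε y).continuousAt

lemma cs_fg_int (ε : ℝ) (hε : 0 < ε) : Integrable (fun y => fSgn ε y * (uGauss ε y)^2) :=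
  (cs_g_int ε hε).bdd_mul (c := 1) (cs_f_cont ε hε).aestronglyMeasurable
    (Filter.Eventually.of_forall (cs_f_le ε hε))

lemma cs_ffg_int (ε : ℝ) (hε : 0 < ε) :
    Integrable (fun y => fSgn ε y * (fSgn ε y * (uGauss ε y)^2)) :=
  (cs_fg_int ε hε).bdd_mul (c := 1) (cs_f_cont ε hε).aestronglyMeasurable
    (Filter.Eventually.of_forall (cs_f_le ε hε))

lemma cs_fg (ε : ℝ) (hε : 0 < ε) : ∫ y, fSgn ε y * (uGauss ε y)^2 = 0 := by
  have := integral_of_hasDerivAt_of_tendsto (f := fun y => (fSgn ε y)^2 / 4)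
    (f' := fun y => fSgn ε y * (uGauss ε y)^2)
    (fun y => by
      refine (((cs_f_deriv ε hε y).pow 2).div_const 4).congr_deriv ?_
      norm_num
      ring) (cs_fg_int ε hε)
    (((cs_f_bot ε hε).pow 2).div_const 4) (((cs_f_top ε hε).pow 2).div_const 4)
  rw [this]; norm_num

lemma cs_ffg (ε : ℝ) (hε : 0 < ε) :
    ∫ y, fSgn ε y * (fSgn ε y * (uGauss ε y)^2) = 1/3 := by
  have := integral_of_hasDerivAt_of_tendsto (f := fun y => (fSgn ε y)^3 / 6)
    (f' := fun y => fSgn ε y * (fSgn ε y * (uGauss ε y)^2))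
    (fun y => by
      refine (((cs_f_deriv ε hε y).pow 3).div_const 6).congr_deriv ?_
      norm_num
      ring) (cs_ffg_int ε hε)
    (((cs_f_bot ε hε).pow 3).div_const 6) (((cs_f_top ε hε).pow 3).div_const 6)
  rw [this]; norm_num

lemma cs_swap (ε : ℝ) (hε : 0 < ε) (h : ℝ → ℝ) (hh : Integrable h) :
    ∫ y, (∫ t, Real.sign (y - t) * h t) * (uGauss ε y)^2 = - ∫ t, fSgn ε t * h t := by
  have hg := cs_g_int ε hε
  have hI : Integrable (Function.uncurry fun y t : ℝ =>
      Real.sign (y - t) * ((uGauss ε y)^2 * h t)) (volume.prod volume) := by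
    refine (hg.mul_prod hh).bdd_mul (c := 1) (f := fun p : ℝ × ℝ => Real.sign (p.1 - p.2)) ?_
      (Filter.Eventually.of_forall fun p => cs_sign_le _)
    exact (cs_sign_meas.comp (measurable_fst.sub measurable_snd)).aestronglyMeasurable
  calc _ = ∫ y, ∫ t, Real.sign (y - t) * ((uGauss ε y)^2 * h t) := by
        congr 1; funext y; rw [← integral_mul_const]; congr 1; funext t; ring
    _ = ∫ t, ∫ y, Real.sign (y - t) * ((uGauss ε y)^2 * h t) := integral_integral_swap hI
    _ = _ := by
        rw [← integral_neg]
        congr 1; funext t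
        unfold fSgn
        rw [← integral_mul_const, ← integral_neg]
        congr 1; funext y
        rw [← neg_sub t y, Real.sign_neg]; ring

/-- The projection onto `u_ε` of the current self-interaction term `−2β (T₀ ⋆ j) Φ`
of the Chern-Simons-Schrödinger equation equals `(2/3) π² β² |φ|⁴ φ`: for every `x`,
`−2β φ(x) ∫ (−π ∫ sgn(y−y′) j₁(x,y′) dy′) u_ε(y)² dy = (2/3) π² β² |φ(x)|⁴ φ(x)`. -/
theorem current_self_interaction_projection (ε β : ℝ) (hε : 0 < ε)
    (φ : ℝ → ℂ) (hφ : Differentiable ℝ φ) (x : ℝ) :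
    ((-2 * β : ℝ) : ℂ) * φ x *
        ((∫ y : ℝ, (-Real.pi * ∫ y' : ℝ, Real.sign (y - y') * j1 ε β φ x y')
            * (uGauss ε y)^2 : ℝ) : ℂ)
      = ((2/3 * Real.pi^2 * β^2 * ‖φ x‖^4 : ℝ) : ℂ) * φ x := by
  have hg := cs_g_int ε hε
  obtain ⟨c, hc⟩ : ∃ c, c = ((starRingEnd ℂ) (φ x) * deriv φ x).im := ⟨_, rfl⟩
  have hj : j1 ε β φ x = fun y => c * (uGauss ε y)^2
      - (Real.pi * β * ‖φ x‖^4) * (fSgn ε y * (uGauss ε y)^2) := by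
    funext y; unfold j1; rw [← hc]; ring
  have hji : Integrable (j1 ε β φ x) := by
    rw [hj]; exact (hg.const_mul _).sub ((cs_fg_int ε hε).const_mul _)
  have h1 : ∫ t, fSgn ε t * j1 ε β φ x t = -(Real.pi * β * ‖φ x‖^4) / 3 := by
    have e : (fun t => fSgn ε t * j1 ε β φ x t) = fun t => c * (fSgn ε t * (uGauss ε t)^2)
        - (Real.pi * β * ‖φ x‖^4) * (fSgn ε t * (fSgn ε t * (uGauss ε t)^2)) := by
      funext t; rw [hj]; ring
    rw [e, integral_sub ((cs_fg_int ε hε).const_mul _) ((cs_ffg_int ε hε).const_mul _),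
      integral_const_mul, integral_const_mul, cs_fg ε hε, cs_ffg ε hε]
    ring
  have h2 : (∫ y : ℝ, (-Real.pi * ∫ y' : ℝ, Real.sign (y - y') * j1 ε β φ x y')
            * (uGauss ε y)^2) = -Real.pi * (Real.pi * β * ‖φ x‖^4 / 3) := by
    simp_rw [mul_assoc (-Real.pi)]
    rw [integral_const_mul, cs_swap ε hε _ hji, h1]
    ring
  rw [h2]
  push_cast
  ring
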